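/- arXiv:math/0211103 — 5 statements merged into one kernel-verified Lean document; each statement's English description precedes it below -/
import Mathlib

section
/- Let μ be a probability measure on a measurable space Ω, let I ⊆ ℝ be a closed interval with nonempty interior, and let Φ : I → ℝ be a differentiable convex function. Then for every measurable f : Ω → I with f and Φ∘f μ-integrable, one has the variational formula Ent_μ^Φ(f) = inf over a in the interior of I of ∫ (Φ(f) − Φ(a) − Φ'(a)·(f − a)) dμ, where each integrand Φ(f) − Φ(a) − Φ'(a)·(f − a) is nonnegative. -/
open MeasureTheory

/-- A convex function lies above its tangent line at an interior point of differentiability. -/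
theorem ConvexOn.add_deriv_mul_sub_le {I : Set ℝ} {Φ : ℝ → ℝ} (hΦ : ConvexOn ℝ I Φ) {a x : ℝ}
    (ha : a ∈ I) (hx : x ∈ I) (hd : DifferentiableAt ℝ Φ a) :
    Φ a + deriv Φ a * (x - a) ≤ Φ x := by
  rcases lt_trichotomy a x with h | rfl | h
  · have := hΦ.le_slope_of_hasDerivAt ha hx h hd.hasDerivAt
    rw [slope_def_field, le_div_iff₀ (sub_pos.2 h)] at this
    linarith
  · simp
  · have := hΦ.slope_le_of_hasDerivAt hx ha h hd.hasDerivAt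
    rw [slope_def_field, div_le_iff₀ (sub_pos.2 h)] at this
    linarith

/-- **Variational (infimum) formula for Φ-entropies.** For a differentiable convex `Φ` on a
closed interval `I` with nonempty interior, the Φ-entropy of `f` equals the infimum over
`a ∈ interior I` of `∫ (Φ(f) − Φ(a) − Φ'(a)·(f − a)) dμ`, each integrand being nonnegative. -/
theorem phiEntropy_inf_formula
    {Ω : Type*} [MeasurableSpace Ω] (μ : Measure Ω) [IsProbabilityMeasure μ]
    (I : Set ℝ) (hI : Convex ℝ I) (hIc : IsClosed I) (hIint : (interior I).Nonempty)
    (Φ : ℝ → ℝ) (hΦdiff : DifferentiableOn ℝ Φ I) (hΦconv : ConvexOn ℝ I Φ)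
    (f : Ω → ℝ) (hfm : Measurable f) (hfI : ∀ ω, f ω ∈ I)
    (hfint : Integrable f μ) (hΦf : Integrable (fun ω => Φ (f ω)) μ) :
    (∀ a ∈ interior I, ∀ ω, 0 ≤ Φ (f ω) - Φ a - deriv Φ a * (f ω - a)) ∧
    IsGLB
      { y : ℝ | ∃ a ∈ interior I,
          y = ∫ ω, (Φ (f ω) - Φ a - deriv Φ a * (f ω - a)) ∂μ }
      ((∫ ω, Φ (f ω) ∂μ) - Φ (∫ x, f x ∂μ)) := by
  have tangent_le : ∀ a ∈ interior I, ∀ x ∈ I, Φ a + deriv Φ a * (x - a) ≤ Φ x :=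
    fun a ha x hx => hΦconv.add_deriv_mul_sub_le (interior_subset ha) hx
      (hΦdiff.differentiableAt (mem_interior_iff_mem_nhds.1 ha))
  have hmI : ∫ x, f x ∂μ ∈ I := hI.integral_mem hIc (.of_forall hfI) hfint
  have integral_eq : ∀ a, ∫ ω, (Φ (f ω) - Φ a - deriv Φ a * (f ω - a)) ∂μ
      = (∫ ω, Φ (f ω) ∂μ) - Φ a - deriv Φ a * ((∫ x, f x ∂μ) - a) := by
    intro a
    have hΦfa : Integrable (fun ω => Φ (f ω) - Φ a) μ := hΦf.sub (integrable_const _)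
    have hfa : Integrable (fun ω => f ω - a) μ := hfint.sub (integrable_const _)
    rw [integral_sub hΦfa (hfa.const_mul _),
      integral_sub hΦf (integrable_const _), integral_const_mul,
      integral_sub hfint (integrable_const _)]
    simp
  set m := ∫ x, f x ∂μ
  refine ⟨fun a ha ω => by linarith [tangent_le a ha _ (hfI ω)], ?_, fun L hL => ?_⟩
  · rintro _ ⟨a, ha, rfl⟩
    rw [integral_eq]
    linarith [tangent_le a ha m hmI]
  obtain ⟨c, hc⟩ := hIint
  have mem_interior : ∀ t ∈ Set.Ioc (0 : ℝ) 1, m + t * (c - m) ∈ interior I :=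
    fun t ht => hI.add_smul_sub_mem_interior hmI hc ht
  have tendsto_Φ : ∀ s ∈ Set.Ioc (0 : ℝ) 1,
      Filter.Tendsto (fun t : ℝ => Φ (m + s * t * (c - m))) (nhdsWithin 0 (Set.Ioc 0 1))
        (nhds (Φ m)) := by
    intro s hs
    refine (hΦdiff.continuousOn m hmI).tendsto.comp (tendsto_nhdsWithin_iff.2 ⟨?_, ?_⟩)
    · have : Continuous fun t : ℝ => m + s * t * (c - m) := by fun_prop
      simpa using (this.tendsto 0).mono_left nhdsWithin_le_nhds
    · filter_upwards [self_mem_nhdsWithin] with t ht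
      exact interior_subset
        (mem_interior _ ⟨mul_pos hs.1 ht.1, mul_le_one₀ hs.2 ht.1.le ht.2⟩)
  have tendsto_bound := (((tendsto_Φ (1 / 2) (by norm_num)).const_mul 2).const_sub
    (∫ ω, Φ (f ω) ∂μ)).add (tendsto_Φ 1 (by norm_num))
  have : (nhdsWithin (0 : ℝ) (Set.Ioc 0 1)).NeBot := by
    rw [nhdsWithin_Ioc_eq_nhdsGT zero_lt_one]
    infer_instance
  have hle := ge_of_tendsto (b := L) tendsto_bound (by
    filter_upwards [self_mem_nhdsWithin] with t ht
    have ha : m + 1 / 2 * t * (c - m) ∈ interior I :=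
      mem_interior _ ⟨by linarith [ht.1], by linarith [ht.1, ht.2]⟩
    have hb : m + 1 * t * (c - m) ∈ I :=
      interior_subset (by simpa using mem_interior t ht)
    have hLa := hL ⟨_, ha, rfl⟩
    rw [integral_eq] at hLa
    linarith [tangent_le _ ha _ hb])
  linarith
end

section
/- Let (Ω_1, μ_1), …, (Ω_n, μ_n) be probability spaces and let μ = μ_1 ⊗ ⋯ ⊗ μ_n be the product probability measure on Ω = Ω_1 × ⋯ × Ω_n. Let I ⊆ ℝ be a closed interval and Φ : I → ℝ a C² convex function satisfying (H1). Then for every bounded measurable f : Ω → I, Ent_μ^Φ(f) ≤ Σ_{i=1}^n ∫ Ent_{μ_i}^Φ(f_i^x) dμ(x), where for x ∈ Ω, f_i^x : Ω_i → I denotes the function y ↦ f(x_1, …, x_{i−1}, y, x_{i+1}, …, x_n) obtained by freezing all coordinates of x except the i-th, and Ent_{μ_i}^Φ(f_i^x) is its Φ-entropy with respect to μ_i. -/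
open MeasureTheory

/-- The Bregman divergence of `Φ`, with `Ψ` in the role of the derivative of `Φ`. -/
def bregman (Φ Ψ : ℝ → ℝ) (p : ℝ × ℝ) : ℝ := Φ p.1 - Φ p.2 - Ψ p.2 * (p.1 - p.2)

/-- If `(u, v) ↦ Φ'' u * v ^ 2` is convex, then the Bregman divergence of `Φ` is jointly convex. -/
theorem convexOn_bregman {U : Set ℝ} (hU : Convex ℝ U) {Φ Φ' Φ'' : ℝ → ℝ}
    (hΦ : ∀ x ∈ U, HasDerivAt Φ (Φ' x) x) (hΦ' : ∀ x ∈ U, HasDerivAt Φ' (Φ'' x) x)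
    (hconv : ConvexOn ℝ (U ×ˢ (Set.univ : Set ℝ)) (fun p : ℝ × ℝ => Φ'' p.1 * p.2 ^ 2)) :
    ConvexOn ℝ (U ×ˢ U) (bregman Φ Φ') := by
  refine ⟨hU.prod hU, ?_⟩
  rintro ⟨u₁, m₁⟩ ⟨hu₁, hm₁⟩ ⟨u₂, m₂⟩ ⟨hu₂, hm₂⟩ a b ha hb hab
  simp only [bregman, Prod.smul_mk, Prod.mk_add_mk, smul_eq_mul] at hu₁ hm₁ hu₂ hm₂ ⊢
  set u := a * u₁ + b * u₂ with hu
  set m := a * m₁ + b * m₂ with hm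
  have huU : u ∈ U := hU hu₁ hu₂ ha hb hab
  have hmU : m ∈ U := hU hm₁ hm₂ ha hb hab
  have hseg : ∀ {v w t : ℝ}, v ∈ U → w ∈ U → t ∈ Set.Icc (0 : ℝ) 1 → w + t * (v - w) ∈ U := by
    intro v w t hv hw ht
    have := hU hw hv (sub_nonneg.2 ht.2) ht.1 (by ring)
    convert this using 1
    simp only [smul_eq_mul]; ring
  have hline : ∀ v w t : ℝ, HasDerivAt (fun t : ℝ => w + t * (v - w)) (v - w) t := fun v w t => by
    simpa using ((hasDerivAt_id t).mul_const (v - w)).const_add w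
  have hd : ∀ {v w t : ℝ}, v ∈ U → w ∈ U → t ∈ Set.Icc (0 : ℝ) 1 →
      HasDerivAt (fun t : ℝ => Φ (w + t * (v - w))) (Φ' (w + t * (v - w)) * (v - w)) t :=
    fun {v w t} hv hw ht => (hΦ _ (hseg hv hw ht)).comp t (hline v w t)
  have hd' : ∀ {v w t : ℝ}, v ∈ U → w ∈ U → t ∈ Set.Icc (0 : ℝ) 1 →
      HasDerivAt (fun t : ℝ => Φ' (w + t * (v - w)) * (v - w))
        (Φ'' (w + t * (v - w)) * (v - w) * (v - w)) t :=
    fun {v w t} hv hw ht => ((hΦ' _ (hseg hv hw ht)).comp t (hline v w t)).mul_const _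
  -- The gap in the convexity inequality for `Φ`, seen along the segments from `mᵢ` to `uᵢ`.
  let φ : ℝ → ℝ := fun t => a * Φ (m₁ + t * (u₁ - m₁)) + b * Φ (m₂ + t * (u₂ - m₂))
    - Φ (m + t * (u - m))
  let φ' : ℝ → ℝ := fun t => a * (Φ' (m₁ + t * (u₁ - m₁)) * (u₁ - m₁))
    + b * (Φ' (m₂ + t * (u₂ - m₂)) * (u₂ - m₂)) - Φ' (m + t * (u - m)) * (u - m)
  let φ'' : ℝ → ℝ := fun t => a * (Φ'' (m₁ + t * (u₁ - m₁)) * (u₁ - m₁) * (u₁ - m₁))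
    + b * (Φ'' (m₂ + t * (u₂ - m₂)) * (u₂ - m₂) * (u₂ - m₂))
    - Φ'' (m + t * (u - m)) * (u - m) * (u - m)
  have hφ : ∀ t ∈ Set.Icc (0 : ℝ) 1, HasDerivAt φ (φ' t) t := fun t ht =>
    (((hd hu₁ hm₁ ht).const_mul a).add ((hd hu₂ hm₂ ht).const_mul b)).sub (hd huU hmU ht)
  have hφ' : ∀ t ∈ Set.Icc (0 : ℝ) 1, HasDerivAt φ' (φ'' t) t := fun t ht =>
    (((hd' hu₁ hm₁ ht).const_mul a).add ((hd' hu₂ hm₂ ht).const_mul b)).sub (hd' huU hmU ht)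
  have hφ'' : ∀ t ∈ Set.Icc (0 : ℝ) 1, 0 ≤ φ'' t := fun t ht => by
    have h := hconv.2 (x := (m₁ + t * (u₁ - m₁), u₁ - m₁)) (y := (m₂ + t * (u₂ - m₂), u₂ - m₂))
      ⟨hseg hu₁ hm₁ ht, trivial⟩ ⟨hseg hu₂ hm₂ ht, trivial⟩ ha hb hab
    simp only [Prod.smul_mk, Prod.mk_add_mk, smul_eq_mul] at h
    have e₁ : a * (m₁ + t * (u₁ - m₁)) + b * (m₂ + t * (u₂ - m₂)) = m + t * (u - m) := by
      rw [hu, hm]; ring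
    have e₂ : a * (u₁ - m₁) + b * (u₂ - m₂) = u - m := by rw [hu, hm]; ring
    rw [e₁, e₂] at h
    simp only [φ'']
    linarith
  have hsub : interior (Set.Icc (0 : ℝ) 1) ⊆ Set.Icc 0 1 := interior_subset
  have hφconv : ConvexOn ℝ (Set.Icc 0 1) φ :=
    convexOn_of_hasDerivWithinAt2_nonneg (convex_Icc 0 1)
      (fun t ht => (hφ t ht).continuousAt.continuousWithinAt)
      (fun t ht => (hφ t (hsub ht)).hasDerivWithinAt)
      (fun t ht => (hφ' t (hsub ht)).hasDerivWithinAt) (fun t ht => hφ'' t (hsub ht))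
  have h := hφconv.le_slope_of_hasDerivAt (x := 0) (y := 1) (by simp) (by simp) one_pos
    (hφ 0 (by simp))
  simp only [slope_def_field, φ, φ', zero_mul, add_zero, one_mul, sub_zero, div_one,
    add_sub_cancel] at h
  linarith

section Integrability

variable {X E : Type*} [MeasurableSpace X] [TopologicalSpace E] [MeasurableSpace E] [BorelSpace E]

theorem measurable_comp_of_continuousOn {K : Set E} {φ : E → ℝ} (hφ : ContinuousOn φ K)
    {g : X → E} (hg : Measurable g) (hgK : ∀ x, g x ∈ K) : Measurable fun x => φ (g x) :=
  hφ.domRestrict.measurable.comp (hg.subtype_mk (h := hgK))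

theorem integrable_comp_of_isCompact {ν : Measure X} [IsFiniteMeasure ν] {K : Set E}
    (hK : IsCompact K) {φ : E → ℝ} (hφ : ContinuousOn φ K) {g : X → E} (hg : Measurable g)
    (hgK : ∀ x, g x ∈ K) : Integrable (fun x => φ (g x)) ν := by
  obtain ⟨C, hC⟩ := hK.exists_bound_of_continuousOn hφ
  exact .of_bound (measurable_comp_of_continuousOn hφ hg hgK).aestronglyMeasurable C
    (.of_forall fun x => hC _ (hgK x))

theorem integrable_of_isCompact {ν : Measure X} [IsFiniteMeasure ν] {K : Set ℝ}
    (hK : IsCompact K) {g : X → ℝ} (hg : Measurable g) (hgK : ∀ x, g x ∈ K) : Integrable g ν :=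
  integrable_comp_of_isCompact hK continuousOn_id hg hgK

end Integrability

theorem measurable_finset_piecewise {ι : Type*} [DecidableEq ι] {Ω : ι → Type*}
    [∀ i, MeasurableSpace (Ω i)] (S : Finset ι) :
    Measurable fun p : (∀ i, Ω i) × (∀ i, Ω i) => S.piecewise p.2 p.1 := by
  refine measurable_pi_lambda _ fun i => ?_
  by_cases hi : i ∈ S <;> simp only [Finset.piecewise, hi, if_true, if_false] <;> fun_prop

theorem measurable_comp_piecewise {ι : Type*} [DecidableEq ι] {Ω : ι → Type*}
    [∀ i, MeasurableSpace (Ω i)] (S : Finset ι) {f : (∀ i, Ω i) → ℝ} (hf : Measurable f)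
    (x : ∀ i, Ω i) : Measurable fun y => f (S.piecewise y x) :=
  (hf.comp (measurable_finset_piecewise S)).comp measurable_prodMk_left

section CoordMean

variable {ι : Type*} [Fintype ι] [DecidableEq ι] {Ω : ι → Type*} [∀ i, MeasurableSpace (Ω i)]

/-- The function obtained from `f` by averaging over the coordinates in `S`. -/
noncomputable def coordMean (μ : ∀ i, Measure (Ω i)) (S : Finset ι) (f : (∀ i, Ω i) → ℝ)
    (x : ∀ i, Ω i) : ℝ :=
  ∫ y, f (S.piecewise y x) ∂Measure.pi μ

variable (μ : ∀ i, Measure (Ω i))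

theorem coordMean_piecewise (S : Finset ι) (f : (∀ i, Ω i) → ℝ) (x y : ∀ i, Ω i) :
    coordMean μ S f (S.piecewise y x) = coordMean μ S f x := by
  simp [coordMean]

theorem coordMean_mul_left (S : Finset ι) (φ : ℝ → ℝ) (f h : (∀ i, Ω i) → ℝ) (x : ∀ i, Ω i) :
    coordMean μ S (fun z => φ (coordMean μ S f z) * h z) x
      = φ (coordMean μ S f x) * coordMean μ S h x := by
  rw [coordMean]
  simp only [coordMean_piecewise]
  rw [integral_const_mul, ← coordMean]

theorem coordMean_univ (f : (∀ i, Ω i) → ℝ) (x : ∀ i, Ω i) :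
    coordMean μ Finset.univ f x = ∫ y, f y ∂Measure.pi μ := by
  simp [coordMean]

variable [∀ i, IsProbabilityMeasure (μ i)]

theorem measurePreserving_finset_piecewise (S : Finset ι) :
    MeasurePreserving (fun p : (∀ i, Ω i) × (∀ i, Ω i) => S.piecewise p.2 p.1)
      ((Measure.pi μ).prod (Measure.pi μ)) (Measure.pi μ) := by
  have hm := measurable_finset_piecewise (Ω := Ω) S
  refine ⟨hm, (Measure.pi_eq fun s hs => ?_).symm⟩
  rw [Measure.map_apply hm (.univ_pi hs)]
  have : (fun p : (∀ i, Ω i) × (∀ i, Ω i) => S.piecewise p.2 p.1) ⁻¹' Set.univ.pi s =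
      (Set.univ.pi fun i => if i ∈ S then Set.univ else s i) ×ˢ
        (Set.univ.pi fun i => if i ∈ S then s i else Set.univ) := by
    ext p
    simp only [Set.mem_preimage, Set.mem_univ_pi, Set.mem_prod, ← forall_and]
    refine forall_congr' fun i => ?_
    by_cases hi : i ∈ S <;> simp [hi]
  rw [this, Measure.prod_prod, Measure.pi_pi, Measure.pi_pi, ← Finset.prod_mul_distrib]
  refine Finset.prod_congr rfl fun i _ => ?_
  by_cases hi : i ∈ S <;> simp [hi]

theorem measurable_coordMean (S : Finset ι) {f : (∀ i, Ω i) → ℝ} (hf : Measurable f) :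
    Measurable (coordMean μ S f) :=
  (StronglyMeasurable.integral_prod_right (ν := Measure.pi μ)
    (f := fun x y => f (S.piecewise y x))
    (hf.comp (measurable_finset_piecewise S)).stronglyMeasurable).measurable

theorem integral_coordMean (S : Finset ι) {f : (∀ i, Ω i) → ℝ}
    (hf : Integrable f (Measure.pi μ)) :
    ∫ x, coordMean μ S f x ∂Measure.pi μ = ∫ x, f x ∂Measure.pi μ := by
  have h := measurePreserving_finset_piecewise μ S
  have hint := h.integrable_comp_of_integrable hf
  have hmap := integral_map h.measurable.aemeasurable (h.map_eq.symm ▸ hf.aestronglyMeasurable)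
  rw [h.map_eq] at hmap
  exact (integral_prod _ hint).symm.trans hmap.symm

theorem coordMean_mem {K : Set ℝ} (hK : IsCompact K) (hKc : Convex ℝ K) (S : Finset ι)
    {f : (∀ i, Ω i) → ℝ} (hf : Measurable f) (hfK : ∀ x, f x ∈ K) (x : ∀ i, Ω i) :
    coordMean μ S f x ∈ K :=
  hKc.integral_mem hK.isClosed (.of_forall fun _ => hfK _)
    (integrable_of_isCompact hK (measurable_comp_piecewise S hf x) fun _ => hfK _)

theorem coordMean_coordMean {K : Set ℝ} (hK : IsCompact K) (S T : Finset ι)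
    {f : (∀ i, Ω i) → ℝ} (hf : Measurable f) (hfK : ∀ x, f x ∈ K) :
    coordMean μ S (coordMean μ T f) = coordMean μ (S ∪ T) f := by
  ext x
  have h := integral_coordMean μ T (f := fun w => f ((S ∪ T).piecewise w x))
    (integrable_of_isCompact hK (measurable_comp_piecewise _ hf x) fun _ => hfK _)
  rw [coordMean, coordMean, ← h]
  refine integral_congr_ae (.of_forall fun y => ?_)
  refine integral_congr_ae (.of_forall fun z => ?_)
  refine congrArg f (funext fun i => ?_)
  by_cases hT : i ∈ T <;> by_cases hS : i ∈ S <;> simp [hT, hS]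

theorem coordMean_empty (f : (∀ i, Ω i) → ℝ) : coordMean μ ∅ f = f := by
  ext x; simp [coordMean]

theorem coordMean_singleton (i : ι) {f : (∀ i, Ω i) → ℝ} (hf : Measurable f) (x : ∀ i, Ω i) :
    coordMean μ {i} f x = ∫ y, f (Function.update x i y) ∂μ i := by
  have hm : Measurable fun y => f (Function.update x i y) := hf.comp (measurable_update x)
  have h := measurePreserving_eval μ i
  rw [← h.map_eq, integral_map h.measurable.aemeasurable hm.aestronglyMeasurable]
  simp [coordMean, Finset.piecewise_singleton]

theorem coordMean_affine {K : Set ℝ} (hK : IsCompact K) (S : Finset ι)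
    {f : (∀ i, Ω i) → ℝ} (hf : Measurable f) (hfK : ∀ x, f x ∈ K) (a b : ℝ) (x : ∀ i, Ω i) :
    coordMean μ S (fun z => a * f z + b) x = a * coordMean μ S f x + b := by
  have hint : Integrable (fun y => f (S.piecewise y x)) (Measure.pi μ) :=
    integrable_of_isCompact hK (measurable_comp_piecewise S hf x) fun _ => hfK _
  rw [coordMean, integral_add (hint.const_mul a) (integrable_const b), integral_const_mul]
  simp [coordMean]

/-- The averages of the Bregman divergence to a coordinate mean are differences of `Φ`-averages. -/
theorem integral_bregman_coordMean {K : Set ℝ} (hK : IsCompact K) (hKc : Convex ℝ K)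
    {Φ Ψ : ℝ → ℝ} (hΦ : ContinuousOn Φ K) (hΨ : ContinuousOn Ψ K) (S : Finset ι)
    {f : (∀ i, Ω i) → ℝ} (hf : Measurable f) (hfK : ∀ x, f x ∈ K) :
    ∫ x, bregman Φ Ψ (f x, coordMean μ S f x) ∂Measure.pi μ
      = ∫ x, Φ (f x) ∂Measure.pi μ - ∫ x, Φ (coordMean μ S f x) ∂Measure.pi μ := by
  have hm := measurable_coordMean μ S hf
  have hmK := coordMean_mem μ hK hKc S hf hfK
  have i₁ : Integrable (fun x => Φ (f x)) (Measure.pi μ) :=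
    integrable_comp_of_isCompact hK hΦ hf hfK
  have i₂ : Integrable (fun x => Φ (coordMean μ S f x)) (Measure.pi μ) :=
    integrable_comp_of_isCompact hK hΦ hm hmK
  have i₃ : Integrable (fun x => Ψ (coordMean μ S f x) * (f x - coordMean μ S f x))
      (Measure.pi μ) :=
    integrable_comp_of_isCompact (φ := fun p : ℝ × ℝ => Ψ p.2 * (p.1 - p.2))
      (g := fun x => (f x, coordMean μ S f x)) (hK.prod hK)
      ((hΨ.comp continuousOn_snd fun _ hp => hp.2).mul (by fun_prop))
      (hf.prodMk hm) fun x => ⟨hfK x, hmK x⟩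
  have hzero : ∫ x, Ψ (coordMean μ S f x) * (f x - coordMean μ S f x) ∂Measure.pi μ = 0 := by
    rw [← integral_coordMean μ S i₃]
    simp only [coordMean_mul_left μ S Ψ f]
    have : ∀ x, coordMean μ S (fun z => f z - coordMean μ S f z) x = 0 := fun x => by
      have := coordMean_affine μ hK S hf hfK 1 (-coordMean μ S f x) x
      simp only [one_mul, add_neg_cancel] at this
      rw [← this, coordMean, coordMean]
      simp only [coordMean_piecewise, sub_eq_add_neg]
    simp [this]
  simp only [bregman]
  have h := integral_sub (i₁.sub i₂) i₃
  simp only [Pi.sub_apply] at h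
  rw [h, integral_sub i₁ i₂, hzero, sub_zero]

/-- Averaging over the coordinates in `S` reduces the `Φ`-entropy in the coordinates `T`. -/
theorem integral_sub_coordMean_union_le {K : Set ℝ} (hK : IsCompact K) (hKc : Convex ℝ K)
    {Φ Ψ : ℝ → ℝ} (hΦ : ContinuousOn Φ K) (hΨ : ContinuousOn Ψ K)
    (hconv : ConvexOn ℝ (K ×ˢ K) (bregman Φ Ψ)) (S T : Finset ι)
    {f : (∀ i, Ω i) → ℝ} (hf : Measurable f) (hfK : ∀ x, f x ∈ K) :
    ∫ x, Φ (coordMean μ S f x) ∂Measure.pi μ - ∫ x, Φ (coordMean μ (T ∪ S) f x) ∂Measure.pi μ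
      ≤ ∫ x, Φ (f x) ∂Measure.pi μ - ∫ x, Φ (coordMean μ T f x) ∂Measure.pi μ := by
  have hS := measurable_coordMean μ S hf
  have hT := measurable_coordMean μ T hf
  have hSK := coordMean_mem μ hK hKc S hf hfK
  have hTK := coordMean_mem μ hK hKc T hf hfK
  have hcont : ContinuousOn (bregman Φ Ψ) (K ×ˢ K) :=
    ((hΦ.comp continuousOn_fst fun _ hp => hp.1).sub
      (hΦ.comp continuousOn_snd fun _ hp => hp.2)).sub
      ((hΨ.comp continuousOn_snd fun _ hp => hp.2).mul (by fun_prop))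
  rw [← coordMean_coordMean μ hK T S hf hfK,
    ← integral_bregman_coordMean μ hK hKc hΦ hΨ T hS hSK,
    ← integral_bregman_coordMean μ hK hKc hΦ hΨ T hf hfK, coordMean_coordMean μ hK T S hf hfK,
    Finset.union_comm, ← coordMean_coordMean μ hK S T hf hfK]
  have hB : Measurable fun x => bregman Φ Ψ (f x, coordMean μ T f x) :=
    measurable_comp_of_continuousOn hcont (hf.prodMk hT) fun x => ⟨hfK x, hTK x⟩
  have hBi : Integrable (fun x => bregman Φ Ψ (f x, coordMean μ T f x)) (Measure.pi μ) :=
    integrable_comp_of_isCompact (hK.prod hK) hcont (hf.prodMk hT) fun x => ⟨hfK x, hTK x⟩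
  obtain ⟨C, hC⟩ := (hK.prod hK).exists_bound_of_continuousOn hcont
  have hBC : ∀ x, bregman Φ Ψ (f x, coordMean μ T f x) ∈ Set.Icc (-C) C := fun x =>
    abs_le.1 (hC _ ⟨hfK x, hTK x⟩)
  rw [← integral_coordMean μ S hBi]
  refine integral_mono ?_ ?_ fun x => ?_
  · exact integrable_comp_of_isCompact (hK.prod hK) hcont
      (hS.prodMk (measurable_coordMean μ S hT))
      fun x => ⟨hSK x, coordMean_mem μ hK hKc S hT hTK x⟩
  · exact integrable_of_isCompact isCompact_Icc (measurable_coordMean μ S hB)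
      (coordMean_mem μ isCompact_Icc (convex_Icc _ _) S hB hBC)
  · have j₁ : Integrable (fun y => f (S.piecewise y x)) (Measure.pi μ) :=
      integrable_of_isCompact hK (measurable_comp_piecewise S hf x) fun _ => hfK _
    have j₂ : Integrable (fun y => coordMean μ T f (S.piecewise y x)) (Measure.pi μ) :=
      integrable_of_isCompact hK (measurable_comp_piecewise S hT x) fun _ => hTK _
    have j₃ : Integrable (fun y => bregman Φ Ψ
        (f (S.piecewise y x), coordMean μ T f (S.piecewise y x))) (Measure.pi μ) :=
      integrable_of_isCompact isCompact_Icc (measurable_comp_piecewise S hB x) fun _ => hBC _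
    have h := hconv.map_integral_le hcont (hK.prod hK).isClosed
      (.of_forall fun y => ⟨hfK (S.piecewise y x), hTK (S.piecewise y x)⟩) (j₁.prodMk j₂) j₃
    rwa [integral_pair j₁ j₂] at h

/-- Subadditivity of the `Φ`-entropy over a set of coordinates. -/
theorem integral_sub_coordMean_le_sum {K : Set ℝ} (hK : IsCompact K) (hKc : Convex ℝ K)
    {Φ Ψ : ℝ → ℝ} (hΦ : ContinuousOn Φ K) (hΨ : ContinuousOn Ψ K)
    (hconv : ConvexOn ℝ (K ×ˢ K) (bregman Φ Ψ)) (S : Finset ι)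
    {f : (∀ i, Ω i) → ℝ} (hf : Measurable f) (hfK : ∀ x, f x ∈ K) :
    ∫ x, Φ (f x) ∂Measure.pi μ - ∫ x, Φ (coordMean μ S f x) ∂Measure.pi μ
      ≤ ∑ i ∈ S, (∫ x, Φ (f x) ∂Measure.pi μ
          - ∫ x, Φ (coordMean μ {i} f x) ∂Measure.pi μ) := by
  induction S using Finset.induction_on with
  | empty => simp [coordMean_empty]
  | insert i S hi ih =>
    rw [Finset.sum_insert hi, Finset.insert_eq]
    linarith [integral_sub_coordMean_union_le μ hK hKc hΦ hΨ hconv S {i} hf hfK]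

end CoordMean

/-- Dominated convergence along the contraction of a bounded function towards a point. -/
theorem tendsto_integral_comp_combo {X : Type*} [MeasurableSpace X] (ν : Measure X)
    [IsFiniteMeasure ν] {J : Set ℝ} (hJ : IsCompact J) (hJc : Convex ℝ J) {Φ : ℝ → ℝ}
    (hΦ : ContinuousOn Φ J) {c : ℝ} (hc : c ∈ J) {g : X → ℝ} (hg : Measurable g)
    (hgJ : ∀ x, g x ∈ J) {s : ℕ → ℝ} (hs : ∀ n, s n ∈ Set.Icc (0 : ℝ) 1)
    (hs₁ : Filter.Tendsto s Filter.atTop (nhds 1)) :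
    Filter.Tendsto (fun n => ∫ x, Φ (s n * g x + (1 - s n) * c) ∂ν) Filter.atTop
      (nhds (∫ x, Φ (g x) ∂ν)) := by
  have hmem : ∀ n x, s n * g x + (1 - s n) * c ∈ J := fun n x =>
    hJc (hgJ x) hc (hs n).1 (sub_nonneg.2 (hs n).2) (by ring)
  obtain ⟨C, hC⟩ := hJ.exists_bound_of_continuousOn hΦ
  refine tendsto_integral_of_dominated_convergence (fun _ => C)
    (fun n => (measurable_comp_of_continuousOn hΦ (by fun_prop) (hmem n)).aestronglyMeasurable)
    (integrable_const C) (fun n => .of_forall fun x => hC _ (hmem n x)) (.of_forall fun x => ?_)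
  refine (hΦ (g x) (hgJ x)).tendsto.comp (tendsto_nhdsWithin_iff.2 ⟨?_, .of_forall (hmem · x)⟩)
  simpa using (hs₁.mul_const (g x)).add ((hs₁.const_sub 1).mul_const c)

/-- **Tensorisation of Φ-entropies.** Under hypothesis `(H1)`, for a product probability
measure `μ = μ_1 ⊗ ⋯ ⊗ μ_n` and a bounded measurable `f` with values in `I`, the Φ-entropy of
`f` with respect to `μ` is bounded by the sum over coordinates `i` of the `μ`-average of the
Φ-entropy of `f` in the `i`-th coordinate alone (all other coordinates being frozen). -/
theorem phiEntropy_tensorisation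
    {ι : Type*} [Fintype ι] [DecidableEq ι] {Ω : ι → Type*} [∀ i, MeasurableSpace (Ω i)]
    (μ : ∀ i, Measure (Ω i)) [∀ i, IsProbabilityMeasure (μ i)]
    (I : Set ℝ) (hI : Convex ℝ I) (hIc : IsClosed I)
    (Φ : ℝ → ℝ) (hΦ : ContDiffOn ℝ 2 Φ I) (hΦconv : ConvexOn ℝ I Φ)
    (hH1nonneg : ∀ u ∈ I, ∀ v : ℝ, 0 ≤ deriv (deriv Φ) u * v ^ 2)
    (hH1conv : ConvexOn ℝ (I ×ˢ (Set.univ : Set ℝ))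
      (fun p : ℝ × ℝ => deriv (deriv Φ) p.1 * p.2 ^ 2))
    (f : (∀ i, Ω i) → ℝ) (hfm : Measurable f) (hfI : ∀ x, f x ∈ I)
    (hfbdd : ∃ C : ℝ, ∀ x, |f x| ≤ C) :
    (∫ x, Φ (f x) ∂(Measure.pi μ)) - Φ (∫ x, f x ∂(Measure.pi μ))
      ≤ ∑ i, ∫ x,
          ((∫ y, Φ (f (Function.update x i y)) ∂(μ i))
            - Φ (∫ y, f (Function.update x i y) ∂(μ i))) ∂(Measure.pi μ) := by

  obtain ⟨C, hC⟩ := hfbdd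
  have hΦc : ContinuousOn Φ I := hΦ.continuousOn
  obtain ⟨J, hJ, hJc, hJI, hfJ, c, hc, hcU⟩ : ∃ J : Set ℝ, IsCompact J ∧ Convex ℝ J ∧ J ⊆ I ∧
      (∀ x, f x ∈ J) ∧ ∃ c ∈ J, (interior I).Nonempty → c ∈ interior I := by
    obtain ⟨c, hcI, hcU⟩ : ∃ c ∈ I, (interior I).Nonempty → c ∈ interior I := by
      by_cases h : (interior I).Nonempty
      · exact ⟨h.some, interior_subset h.some_mem, fun _ => h.some_mem⟩
      · obtain ⟨x⟩ : Nonempty (∀ i, Ω i) := (Measure.pi μ).nonempty_of_neZero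
        exact ⟨f x, hfI x, fun h' => absurd h' h⟩
    refine ⟨I ∩ Set.Icc (-max C |c|) (max C |c|), isCompact_Icc.inter_left hIc,
      hI.inter (convex_Icc _ _), Set.inter_subset_left, fun x => ⟨hfI x, ?_⟩, c, ⟨hcI, ?_⟩, hcU⟩
    · exact abs_le.1 ((hC x).trans (le_max_left _ _))
    · exact abs_le.1 (le_max_right _ _)
  have hΦJ : ContinuousOn Φ J := hΦc.mono hJI
  have hmeas : ∀ S, Measurable (coordMean μ S f) := fun S => measurable_coordMean μ S hfm
  have hmem : ∀ S x, coordMean μ S f x ∈ J := fun S => coordMean_mem μ hJ hJc S hfm hfJ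
  suffices key : ∫ x, Φ (f x) ∂Measure.pi μ - ∫ x, Φ (coordMean μ Finset.univ f x) ∂Measure.pi μ
      ≤ ∑ i, (∫ x, Φ (f x) ∂Measure.pi μ - ∫ x, Φ (coordMean μ {i} f x) ∂Measure.pi μ) by
    have hΦf : Measurable fun x => Φ (f x) := measurable_comp_of_continuousOn hΦJ hfm hfJ
    have hΦi : Integrable (fun x => Φ (f x)) (Measure.pi μ) :=
      integrable_comp_of_isCompact hJ hΦJ hfm hfJ
    simp only [coordMean_univ, integral_const, probReal_univ, one_smul] at key
    refine key.trans_eq (Finset.sum_congr rfl fun i _ => ?_)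
    simp only [← coordMean_singleton μ i hfm, ← coordMean_singleton μ i hΦf]
    obtain ⟨B, hB⟩ := hJ.exists_bound_of_continuousOn hΦJ
    rw [integral_sub, integral_coordMean μ {i} hΦi]
    · have hΦB : ∀ x, Φ (f x) ∈ Set.Icc (-B) B := fun x => abs_le.1 (hB _ (hfJ x))
      exact integrable_of_isCompact isCompact_Icc (measurable_coordMean μ {i} hΦf)
        (coordMean_mem μ isCompact_Icc (convex_Icc _ _) {i} hΦf hΦB)
    · exact integrable_comp_of_isCompact hJ hΦJ (hmeas {i}) (hmem {i})
  by_cases hne : (interior I).Nonempty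
  · -- Contract `f` into the interior of `I`, and pass to the limit.
    have hcI := hcU hne
    let s : ℕ → ℝ := fun n => 1 - 1 / ((n : ℝ) + 1)
    have hs₁ : Filter.Tendsto s Filter.atTop (nhds 1) := by
      simpa [s] using tendsto_one_div_add_atTop_nhds_zero_nat (𝕜 := ℝ).const_sub 1
    have hs : ∀ n, s n ∈ Set.Ico (0 : ℝ) 1 := fun n => by
      have h₁ : 0 < 1 / ((n : ℝ) + 1) := by positivity
      have h₂ : 1 / ((n : ℝ) + 1) ≤ 1 := by
        rw [div_le_one (by positivity)]; linarith [Nat.cast_nonneg (α := ℝ) n]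
      exact ⟨sub_nonneg.2 h₂, by simp only [s]; linarith⟩
    have hlim : ∀ {g : (∀ i, Ω i) → ℝ}, Measurable g → (∀ x, g x ∈ J) →
        Filter.Tendsto (fun n => ∫ x, Φ (s n * g x + (1 - s n) * c) ∂Measure.pi μ) Filter.atTop
          (nhds (∫ x, Φ (g x) ∂Measure.pi μ)) := fun hg hgJ =>
      tendsto_integral_comp_combo _ hJ hJc hΦJ hc hg hgJ (fun n => Set.Ico_subset_Icc_self (hs n))
        hs₁
    refine le_of_tendsto_of_tendsto' ((hlim hfm hfJ).sub (hlim (hmeas _) (hmem _)))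
      (tendsto_finsetSum _ fun i _ => (hlim hfm hfJ).sub (hlim (hmeas {i}) (hmem {i})))
      fun n => ?_
    let K : Set ℝ := (fun t => s n * t + (1 - s n) * c) '' J
    have hK : IsCompact K := hJ.image (by fun_prop)
    have hKc : Convex ℝ K := by
      have := hJc.affinity ((1 - s n) * c) (s n)
      simpa [K, add_comm] using this
    have hKU : K ⊆ interior I := by
      rintro _ ⟨t, ht, rfl⟩
      exact hI.combo_self_interior_mem_interior (hJI ht) hcI (hs n).1 (sub_pos.2 (hs n).2)
        (by ring)
    have hΦU : ContDiffOn ℝ 2 Φ (interior I) := hΦ.mono interior_subset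
    have hΦ'U : ContDiffOn ℝ 1 (deriv Φ) (interior I) :=
      hΦU.deriv_of_isOpen isOpen_interior (by norm_num)
    have hbreg : ConvexOn ℝ (interior I ×ˢ interior I) (bregman Φ (deriv Φ)) :=
      convexOn_bregman hI.interior
        (fun x hx => ((hΦU.differentiableOn (by norm_num)).differentiableAt
          (isOpen_interior.mem_nhds hx)).hasDerivAt)
        (fun x hx => ((hΦ'U.differentiableOn (by norm_num)).differentiableAt
          (isOpen_interior.mem_nhds hx)).hasDerivAt)
        (hH1conv.subset (Set.prod_mono_left interior_subset) (hI.interior.prod convex_univ))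
    have h := integral_sub_coordMean_le_sum μ hK hKc (hΦU.continuousOn.mono hKU)
      (hΦ'U.continuousOn.mono hKU) (hbreg.subset (Set.prod_mono hKU hKU) (hKc.prod hKc))
      Finset.univ (f := fun x => s n * f x + (1 - s n) * c) (by fun_prop)
      fun x => Set.mem_image_of_mem _ (hfJ x)
    simpa only [coordMean_affine μ hJ _ hfm hfJ] using h
  · have hsub : I.Subsingleton := by
      by_contra h
      exact hne (hI.nontrivial_iff_nonempty_interior.1 (Set.not_subsingleton_iff.1 h))
    have hconst : ∀ S x, coordMean μ S f x = f x := fun S x =>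
      hsub (hJI (hmem S x)) (hfI x)
    simp [hconst]
end

section
/- Let I ⊆ ℝ be a closed interval and Φ : I → ℝ a C² convex function satisfying (H1). Let μ_1, μ_2 be probability measures on ℝ^d and c_1, c_2 > 0 be such that for i = 1, 2 and every smooth f : ℝ^d → I that is bounded with bounded gradient, Ent_{μ_i}^Φ(f) ≤ c_i · ∫ Φ''(f) · ‖∇f‖² dμ_i. Then the convolution μ_1 * μ_2 (the pushforward of μ_1 ⊗ μ_2 under addition) satisfies, for every smooth f : ℝ^d → I that is bounded with bounded gradient, Ent_{μ_1 * μ_2}^Φ(f) ≤ (c_1 + c_2) · ∫ Φ''(f) · ‖∇f‖² d(μ_1 * μ_2). -/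
open MeasureTheory

open Filter Topology

/-- A function that is continuous on a convex set with nonempty interior and convex on the
interior is convex on the whole set. -/
theorem ConvexOn.of_interior_of_continuousOn {E : Type*} [NormedAddCommGroup E] [NormedSpace ℝ E]
    {s : Set E} {F : E → ℝ} (hs : Convex ℝ s) (hne : (interior s).Nonempty)
    (hF : ContinuousOn F s) (hc : ConvexOn ℝ (interior s) F) : ConvexOn ℝ s F := by
  obtain ⟨c, hcs⟩ := hne
  have key : ∀ x ∈ s, Tendsto (fun t : ℝ => F (x + t • (c - x))) (𝓝[Set.Ioc 0 1] 0) (𝓝 (F x)) := by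
    intro x hx
    refine (hF x hx).tendsto.comp (tendsto_nhdsWithin_iff.2 ⟨?_, ?_⟩)
    · have : Continuous (fun t : ℝ => x + t • (c - x)) := by fun_prop
      simpa using (this.tendsto 0).mono_left (nhdsWithin_le_nhds (s := Set.Ioc (0 : ℝ) 1))
    · filter_upwards [self_mem_nhdsWithin] with t ht
      exact interior_subset (hs.add_smul_sub_mem_interior hx hcs ht)
  have hbot : (𝓝[Set.Ioc (0 : ℝ) 1] 0).NeBot := by
    rw [nhdsWithin_Ioc_eq_nhdsGT one_pos]; infer_instance
  refine ⟨hs, fun x hx y hy a b ha hb hab => ?_⟩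
  refine le_of_tendsto_of_tendsto (key _ (hs hx hy ha hb hab))
    (((key x hx).const_smul a).add ((key y hy).const_smul b)) ?_
  filter_upwards [self_mem_nhdsWithin] with t ht
  have h := hc.2 (hs.add_smul_sub_mem_interior hx hcs ht)
    (hs.add_smul_sub_mem_interior hy hcs ht) ha hb hab
  have e : a • (x + t • (c - x)) + b • (y + t • (c - y))
      = a • x + b • y + t • (c - (a • x + b • y)) := by
    obtain rfl : b = 1 - a := by linarith
    module
  rwa [e] at h

/-- A `C²` function on a convex set with nonempty interior has a second derivative on the
interior that extends continuously to the set. -/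
theorem ContDiffOn.exists_continuousOn_eq_deriv_deriv {I : Set ℝ} {Φ : ℝ → ℝ}
    (hI : Convex ℝ I) (hne : (interior I).Nonempty) (hΦ : ContDiffOn ℝ 2 Φ I) :
    ∃ g : ℝ → ℝ, ContinuousOn g I ∧ ∀ u ∈ interior I, g u = deriv (deriv Φ) u := by
  have hu := uniqueDiffOn_convex hI hne
  refine ⟨derivWithin (derivWithin Φ I) I, ?_, fun u hui => ?_⟩
  · exact ((hΦ.derivWithin (m := 1) hu (by norm_num)).derivWithin (m := 0) hu
      (by norm_num)).continuousOn
  · rw [derivWithin_of_mem_nhds (mem_interior_iff_mem_nhds.1 hui)]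
    refine EventuallyEq.deriv_eq ?_
    filter_upwards [isOpen_interior.mem_nhds hui] with v hv
    exact derivWithin_of_mem_nhds (mem_interior_iff_mem_nhds.1 hv)

/-- A real function with values in a convex set has zero derivative wherever its value is not
in the interior of the set. -/
theorem fderiv_eq_zero_of_notMem_interior {E : Type*} [NormedAddCommGroup E] [NormedSpace ℝ E]
    {I : Set ℝ} (hI : Convex ℝ I) {f : E → ℝ} (hf : ∀ x, f x ∈ I) {x : E}
    (hx : f x ∉ interior I) : fderiv ℝ f x = 0 := by
  by_cases h : ∀ y, f x ≤ f y
  · exact IsLocalMin.fderiv_eq_zero (Eventually.of_forall h)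
  by_cases h' : ∀ y, f y ≤ f x
  · exact IsLocalMax.fderiv_eq_zero (Eventually.of_forall h')
  push Not at h h'
  obtain ⟨y, hy⟩ := h
  obtain ⟨z, hz⟩ := h'
  refine absurd (mem_interior_iff_mem_nhds.2 ?_) hx
  exact mem_of_superset (Icc_mem_nhds hy hz) (hI.ordConnected.out (hf y) (hf z))

theorem norm_gradient_eq_norm_fderiv {E : Type*} [NormedAddCommGroup E] [InnerProductSpace ℝ E]
    [CompleteSpace E] (f : E → ℝ) (x : E) : ‖gradient f x‖ = ‖fderiv ℝ f x‖ := by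
  simp [gradient]

/-- The composition of a bounded continuous function with values in a closed set `I` and a
function continuous on `I` is continuous and bounded. -/
theorem ContinuousOn.comp_bounded {X : Type*} [TopologicalSpace X] {I : Set ℝ} (hI : IsClosed I)
    {q : ℝ → ℝ} (hq : ContinuousOn q I) {f : X → ℝ} (hf : Continuous f) (hfI : ∀ x, f x ∈ I) :
    Continuous (fun x => q (f x)) ∧ ∀ C : ℝ, ∃ M : ℝ, ∀ u ∈ I, |u| ≤ C → |q u| ≤ M := by
  refine ⟨hq.comp_continuous hf hfI, fun C => ?_⟩
  have hK : IsCompact (I ∩ Set.Icc (-C) C) := isCompact_Icc.inter_left hI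
  obtain ⟨M, hM⟩ := hK.exists_bound_of_continuousOn (hq.mono Set.inter_subset_left)
  exact ⟨M, fun u hu huC => hM u ⟨hu, abs_le.1 huC⟩⟩

theorem integrable_of_continuous_of_bounded {X F : Type*} [TopologicalSpace X]
    [MeasurableSpace X] [OpensMeasurableSpace X] [NormedAddCommGroup F]
    [SecondCountableTopologyEither X F] {m : Measure X} [IsFiniteMeasure m] {f : X → F}
    (hf : Continuous f) {C : ℝ} (hC : ∀ x, ‖f x‖ ≤ C) : Integrable f m :=
  Integrable.of_bound hf.aestronglyMeasurable C (Eventually.of_forall hC)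

theorem continuous_integral_translate {E F : Type*} [NormedAddCommGroup E] [MeasurableSpace E]
    [BorelSpace E] [SecondCountableTopology E] [NormedAddCommGroup F] [NormedSpace ℝ F]
    (m : Measure E) [IsFiniteMeasure m] {f : E → F}
    (hf : Continuous f) {C : ℝ} (hC : ∀ x, ‖f x‖ ≤ C) :
    Continuous (fun y => ∫ w, f (w + y) ∂m) :=
  continuous_of_dominated (bound := fun _ => C)
    (fun y => (hf.comp (continuous_add_const y)).aestronglyMeasurable)
    (fun _ => Eventually.of_forall fun _ => hC _) (integrable_const C)
    (Eventually.of_forall fun _ => by fun_prop)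

theorem norm_integral_le_of_forall_norm_le {X F : Type*} [MeasurableSpace X]
    [NormedAddCommGroup F] [NormedSpace ℝ F] (m : Measure X) [IsProbabilityMeasure m] {f : X → F}
    {C : ℝ} (hC : ∀ x, ‖f x‖ ≤ C) : ‖∫ w, f w ∂m‖ ≤ C := by
  simpa using norm_integral_le_of_norm_le_const (μ := m) (Eventually.of_forall hC)

theorem hasFDerivAt_integral_translate {E : Type*} [NormedAddCommGroup E] [NormedSpace ℝ E]
    [MeasurableSpace E] [BorelSpace E] [SecondCountableTopology E] (m : Measure E)
    [IsFiniteMeasure m] {f : E → ℝ} (hf : ContDiff ℝ 1 f) {C C' : ℝ}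
    (hC : ∀ x, ‖f x‖ ≤ C) (hC' : ∀ x, ‖fderiv ℝ f x‖ ≤ C') (y : E) :
    HasFDerivAt (fun y => ∫ w, f (w + y) ∂m) (∫ w, fderiv ℝ f (w + y) ∂m) y := by
  have hcd : Continuous (fderiv ℝ f) := hf.continuous_fderiv one_ne_zero
  refine hasFDerivAt_integral_of_dominated_of_fderiv_le (bound := fun _ => C') univ_mem
    (F' := fun y w => fderiv ℝ f (w + y))
    (Eventually.of_forall fun y => ?_) ?_ ?_ ?_ (integrable_const _) ?_
  · exact (hf.continuous.comp (continuous_add_const y)).aestronglyMeasurable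
  · exact integrable_of_continuous_of_bounded (hf.continuous.comp (continuous_add_const y))
      (fun x => hC _)
  · exact (hcd.comp (continuous_add_const y)).aestronglyMeasurable
  · exact Eventually.of_forall fun _ _ _ => hC' _
  · refine Eventually.of_forall fun w z _ => ?_
    have h := ((hf.differentiable one_ne_zero) (w + z)).hasFDerivAt
    simpa [Function.comp_def] using h.comp z ((hasFDerivAt_id z).const_add w)

/-- There is a sequence of probability measures tending to the Dirac mass at `0` such that
convolution with each of them turns continuous functions into smooth functions. -/
theorem exists_smoothing_probabilityMeasures (E : Type*) [NormedAddCommGroup E]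
    [InnerProductSpace ℝ E] [FiniteDimensional ℝ E] [MeasurableSpace E] [BorelSpace E] :
    ∃ κ : ℕ → Measure E, (∀ n, IsProbabilityMeasure (κ n)) ∧ ∀ h : E → ℝ, Continuous h →
      (∀ n, ContDiff ℝ (⊤ : ℕ∞) (fun y => ∫ z, h (y - z) ∂(κ n))) ∧
      ∀ y, Tendsto (fun n => ∫ z, h (y - z) ∂(κ n)) atTop (𝓝 (h y)) := by
  let φ : ℕ → ContDiffBump (0 : E) := fun n =>
    { rIn := 1 / (n + 1) / 2, rOut := 1 / (n + 1), rIn_pos := by positivity,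
      rIn_lt_rOut := half_lt_self (by positivity) }
  have hφ : Tendsto (fun n => (φ n).rOut) atTop (𝓝 0) := tendsto_one_div_add_atTop_nhds_zero_nat
  let ρ : ℕ → E → ℝ := fun n => (φ n).normed volume
  have hρ0 : ∀ n z, 0 ≤ ρ n z := fun n => (φ n).nonneg_normed
  have hρc : ∀ n, Continuous (ρ n) := fun n => (φ n).continuous_normed
  let κ : ℕ → Measure E := fun n => volume.withDensity (fun z => ENNReal.ofReal (ρ n z))
  have hκ : ∀ n (h : E → ℝ), (fun y => ∫ z, h (y - z) ∂(κ n))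
      = convolution (ρ n) h (ContinuousLinearMap.lsmul ℝ ℝ) volume := by
    intro n h
    ext y
    rw [integral_withDensity_eq_integral_toReal_smul (by have := hρc n; fun_prop)
      (Eventually.of_forall fun _ => ENNReal.ofReal_lt_top)]
    simp [convolution, ENNReal.toReal_ofReal (hρ0 n _)]
  refine ⟨κ, fun n => ⟨?_⟩, fun h hh => ⟨fun n => ?_, fun y => ?_⟩⟩
  · rw [withDensity_apply _ MeasurableSet.univ, Measure.restrict_univ,
      ← ofReal_integral_eq_lintegral_ofReal (φ n).integrable_normed
        (Eventually.of_forall (hρ0 n)), (φ n).integral_normed, ENNReal.ofReal_one]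
  · rw [hκ]
    exact (φ n).hasCompactSupport_normed.contDiff_convolution_left _ (φ n).contDiff_normed
      hh.locallyIntegrable
  · have := ContDiffBump.convolution_tendsto_right_of_continuous (μ := volume) hφ hh y
    exact this.congr fun n => (congrFun (hκ n h) y).symm

/-- Jensen's inequality for the energy of a translation average. -/
theorem energy_integral_translate_le {E : Type*} [NormedAddCommGroup E] [NormedSpace ℝ E]
    [MeasurableSpace E] [BorelSpace E] [SecondCountableTopology E]
    {I : Set ℝ} (hI : Convex ℝ I) (hIc : IsClosed I) {g : ℝ → ℝ} (hg : ContinuousOn g I)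
    (hg0 : ∀ u ∈ I, 0 ≤ g u)
    (hconv : ConvexOn ℝ (I ×ˢ (Set.univ : Set ℝ)) (fun p : ℝ × ℝ => g p.1 * p.2 ^ 2))
    (m : Measure E) [IsProbabilityMeasure m] {f : E → ℝ} (hf : ContDiff ℝ 1 f)
    (hfI : ∀ x, f x ∈ I) {C C' : ℝ} (hC : ∀ x, ‖f x‖ ≤ C) (hC' : ∀ x, ‖fderiv ℝ f x‖ ≤ C')
    (y : E) :
    g (∫ w, f (w + y) ∂m) * ‖fderiv ℝ (fun y => ∫ w, f (w + y) ∂m) y‖ ^ 2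
      ≤ ∫ w, g (f (w + y)) * ‖fderiv ℝ f (w + y)‖ ^ 2 ∂m := by
  have hcd : Continuous (fderiv ℝ f) := hf.continuous_fderiv one_ne_zero
  have hc : Continuous f := hf.continuous
  have hfi : Integrable (fun w => f (w + y)) m :=
    integrable_of_continuous_of_bounded (by fun_prop) (fun x => hC _)
  have hdi : Integrable (fun w => ‖fderiv ℝ f (w + y)‖) m :=
    (integrable_of_continuous_of_bounded (f := fun w => fderiv ℝ f (w + y))
      (by fun_prop) (fun x => hC' _)).norm
  obtain ⟨hgf, hgb⟩ := hg.comp_bounded hIc hc hfI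
  obtain ⟨M, hM⟩ := hgb C
  have hGi : Integrable (fun w => g (f (w + y)) * ‖fderiv ℝ f (w + y)‖ ^ 2) m := by
    have h1 : Continuous (fun w => g (f (w + y))) := hgf.comp (continuous_add_const y)
    refine integrable_of_continuous_of_bounded (C := M * C' ^ 2)
      (h1.mul ((hcd.comp (continuous_add_const y)).norm.pow 2)) (fun x => ?_)
    rw [norm_mul, norm_pow, norm_norm]
    have hM' := hM _ (hfI (x + y)) (hC _)
    exact mul_le_mul hM' (pow_le_pow_left₀ (norm_nonneg _) (hC' _) 2) (by positivity)
      ((abs_nonneg _).trans hM')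
  rw [(hasFDerivAt_integral_translate m hf hC hC' y).fderiv]
  have hmem : ∫ w, f (w + y) ∂m ∈ I :=
    hI.integral_mem hIc (Eventually.of_forall fun _ => hfI _) hfi
  have hJ := hconv.map_integral_le (μ := m) (f := fun w => (f (w + y), ‖fderiv ℝ f (w + y)‖))
    ((hg.comp continuousOn_fst fun p hp => hp.1).mul (continuousOn_snd.pow 2))
    (hIc.prod isClosed_univ) (Eventually.of_forall fun w => ⟨hfI _, trivial⟩)
    (hfi.prodMk hdi) hGi
  rw [integral_pair hfi hdi] at hJ
  refine le_trans ?_ hJ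
  exact mul_le_mul_of_nonneg_left
    (pow_le_pow_left₀ (norm_nonneg _) (norm_integral_le_integral_norm _) 2) (hg0 _ hmem)

/-- The `Φ`-Sobolev inequality with constant `c` for `μ`, with energy density `g(f) ‖Df‖²`. -/
def PhiSobolev {E : Type*} [NormedAddCommGroup E] [NormedSpace ℝ E] [MeasurableSpace E]
    (I : Set ℝ) (Φ g : ℝ → ℝ) (μ : Measure E) (c : ℝ) : Prop :=
  ∀ f : E → ℝ, ContDiff ℝ (⊤ : ℕ∞) f → (∀ x, f x ∈ I) →
    (∃ C : ℝ, ∀ x, |f x| ≤ C) → (∃ C : ℝ, ∀ x, ‖fderiv ℝ f x‖ ≤ C) →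
    (∫ x, Φ (f x) ∂μ) - Φ (∫ x, f x ∂μ) ≤ c * ∫ x, g (f x) * ‖fderiv ℝ f x‖ ^ 2 ∂μ

theorem integral_translate_map_sub {E : Type*} [NormedAddCommGroup E]
    [MeasurableSpace E] [BorelSpace E] [SecondCountableTopology E]
    (m κ : Measure E) [IsProbabilityMeasure m] [IsProbabilityMeasure κ] {f : E → ℝ}
    (hf : Continuous f) {C : ℝ} (hC : ∀ x, ‖f x‖ ≤ C) (y : E) :
    ∫ w, f (w + y) ∂((m.prod κ).map fun p => p.1 - p.2)
      = ∫ z, (∫ w, f (w + (y - z)) ∂m) ∂κ := by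
  have hc : Continuous fun w => f (w + y) := by fun_prop
  rw [integral_map (by fun_prop) hc.aestronglyMeasurable, integral_prod_symm]
  · simp only [sub_add_eq_add_sub, add_sub_assoc]
  · exact integrable_of_continuous_of_bounded (by fun_prop) (fun x => hC _)

/-- A `Φ`-Sobolev inequality for `μ` applies to translation averages of smooth functions, which
need not be smooth, with the average of the energy on the right-hand side. -/
theorem PhiSobolev.integral_translate {E : Type*} [NormedAddCommGroup E] [InnerProductSpace ℝ E]
    [FiniteDimensional ℝ E] [MeasurableSpace E] [BorelSpace E]
    {I : Set ℝ} (hI : Convex ℝ I) (hIc : IsClosed I) {Φ g : ℝ → ℝ} (hΦ : ContinuousOn Φ I)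
    (hg : ContinuousOn g I) (hg0 : ∀ u ∈ I, 0 ≤ g u)
    (hconv : ConvexOn ℝ (I ×ˢ (Set.univ : Set ℝ)) (fun p : ℝ × ℝ => g p.1 * p.2 ^ 2))
    {μ : Measure E} [IsProbabilityMeasure μ] {c : ℝ} (hc : 0 ≤ c) (hμ : PhiSobolev I Φ g μ c)
    (m : Measure E) [IsProbabilityMeasure m] {f : E → ℝ} (hf : ContDiff ℝ 1 f)
    (hfI : ∀ x, f x ∈ I) {C C' M : ℝ} (hC : ∀ x, ‖f x‖ ≤ C) (hC' : ∀ x, ‖fderiv ℝ f x‖ ≤ C')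
    (hGc : Continuous fun x => g (f x) * ‖fderiv ℝ f x‖ ^ 2)
    (hM : ∀ x, ‖g (f x) * ‖fderiv ℝ f x‖ ^ 2‖ ≤ M) :
    (∫ y, Φ (∫ w, f (w + y) ∂m) ∂μ) - Φ (∫ y, (∫ w, f (w + y) ∂m) ∂μ)
      ≤ c * ∫ y, (∫ w, g (f (w + y)) * ‖fderiv ℝ f (w + y)‖ ^ 2 ∂m) ∂μ := by
  obtain ⟨κ, hκp, hκ⟩ := exists_smoothing_probabilityMeasures E
  have hcf : Continuous f := hf.continuous
  have hint : ∀ (m : Measure E) [IsProbabilityMeasure m] (y : E),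
      Integrable (fun w => f (w + y)) m := fun m _ y =>
    integrable_of_continuous_of_bounded (by fun_prop) (fun x => hC _)
  have hmemI : ∀ (m : Measure E) [IsProbabilityMeasure m] (y : E), ∫ w, f (w + y) ∂m ∈ I :=
    fun m _ y => hI.integral_mem hIc (Eventually.of_forall fun _ => hfI _) (hint m y)
  have hbd : ∀ (m : Measure E) [IsProbabilityMeasure m] (y : E), ‖∫ w, f (w + y) ∂m‖ ≤ C :=
    fun m _ y => norm_integral_le_of_forall_norm_le m fun w => hC (w + y)
  set G : E → ℝ := fun x => g (f x) * ‖fderiv ℝ f x‖ ^ 2 with hG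
  let mm : ℕ → Measure E := fun n => (m.prod (κ n)).map fun p => p.1 - p.2
  have hmm : ∀ n, IsProbabilityMeasure (mm n) := fun n =>
    Measure.isProbabilityMeasure_map (by fun_prop)
  let H : ℕ → E → ℝ := fun n y => ∫ w, f (w + y) ∂(mm n)
  let K : ℕ → E → ℝ := fun n y => ∫ w, G (w + y) ∂(mm n)
  have hHc : Continuous fun y => ∫ w, f (w + y) ∂m := continuous_integral_translate m hcf hC
  have hKc : Continuous fun y => ∫ w, G (w + y) ∂m := continuous_integral_translate m hGc hM
  have hHnc : ∀ n, Continuous (H n) := fun n => continuous_integral_translate (mm n) hcf hC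
  have hKnc : ∀ n, Continuous (K n) := fun n => continuous_integral_translate (mm n) hGc hM
  have hHlim : ∀ y, Tendsto (fun n => H n y) atTop (𝓝 (∫ w, f (w + y) ∂m)) := fun y =>
    ((hκ _ hHc).2 y).congr fun n => (integral_translate_map_sub m (κ n) hcf hC y).symm
  have hKlim : ∀ y, Tendsto (fun n => K n y) atTop (𝓝 (∫ w, G (w + y) ∂m)) := fun y =>
    ((hκ _ hKc).2 y).congr fun n => (integral_translate_map_sub m (κ n) hGc hM y).symm
  have hHsmooth : ∀ n, ContDiff ℝ (⊤ : ℕ∞) (H n) := fun n => by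
    have e : H n = _ := funext fun y => integral_translate_map_sub m (κ n) hcf hC y
    rw [e]
    exact (hκ _ hHc).1 n
  have hstep : ∀ n, (∫ y, Φ (H n y) ∂μ) - Φ (∫ y, H n y ∂μ) ≤ c * ∫ y, K n y ∂μ := fun n => by
    refine (hμ (H n) (hHsmooth n) (hmemI (mm n)) ⟨C, hbd (mm n)⟩ ⟨C', fun y => ?_⟩).trans ?_
    · rw [(hasFDerivAt_integral_translate (mm n) hf hC hC' y).fderiv]
      exact norm_integral_le_of_forall_norm_le (mm n) fun w => hC' (w + y)
    · refine mul_le_mul_of_nonneg_left ?_ hc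
      refine integral_mono_of_nonneg (Eventually.of_forall fun y => ?_)
        (integrable_of_continuous_of_bounded (hKnc n)
          fun y => norm_integral_le_of_forall_norm_le (mm n) fun w => hM (w + y))
        (Eventually.of_forall fun y =>
          energy_integral_translate_le hI hIc hg hg0 hconv (mm n) hf hfI hC hC' y)
      exact mul_nonneg (hg0 _ (hmemI (mm n) y)) (by positivity)
  obtain ⟨B, hB⟩ := (hΦ.comp_bounded hIc hcf hfI).2 C
  have hl1 : Tendsto (fun n => ∫ y, Φ (H n y) ∂μ) atTop (𝓝 (∫ y, Φ (∫ w, f (w + y) ∂m) ∂μ)) := by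
    refine tendsto_integral_of_dominated_convergence (fun _ => B)
      (fun n => (hΦ.comp_continuous (hHnc n) (hmemI (mm n))).aestronglyMeasurable)
      (integrable_const B)
      (fun n => Eventually.of_forall fun y => hB _ (hmemI (mm n) y) (hbd (mm n) y))
      (Eventually.of_forall fun y => ?_)
    exact (hΦ _ (hmemI m y)).tendsto.comp
      (tendsto_nhdsWithin_iff.2 ⟨hHlim y, Eventually.of_forall fun n => hmemI (mm n) y⟩)
  have hl2 : Tendsto (fun n => ∫ y, H n y ∂μ) atTop (𝓝 (∫ y, (∫ w, f (w + y) ∂m) ∂μ)) :=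
    tendsto_integral_of_dominated_convergence (fun _ => C)
      (fun n => (hHnc n).aestronglyMeasurable) (integrable_const C)
      (fun n => Eventually.of_forall (hbd (mm n))) (Eventually.of_forall hHlim)
  have hl3 : Tendsto (fun n => ∫ y, K n y ∂μ) atTop (𝓝 (∫ y, (∫ w, G (w + y) ∂m) ∂μ)) :=
    tendsto_integral_of_dominated_convergence (fun _ => M)
      (fun n => (hKnc n).aestronglyMeasurable) (integrable_const M)
      (fun n => Eventually.of_forall fun y =>
        norm_integral_le_of_forall_norm_le (mm n) fun w => hM (w + y))
      (Eventually.of_forall hKlim)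
  have hmem2 : ∀ h : E → ℝ, Continuous h → (∀ y, h y ∈ I) → (∀ y, ‖h y‖ ≤ C) → ∫ y, h y ∂μ ∈ I :=
    fun h hh hhI hhC => hI.integral_mem hIc (Eventually.of_forall hhI)
      (integrable_of_continuous_of_bounded hh hhC)
  have hl2' := (hΦ _ (hmem2 _ hHc (hmemI m) (hbd m))).tendsto.comp
    (tendsto_nhdsWithin_iff.2 ⟨hl2, Eventually.of_forall fun n =>
      hmem2 _ (hHnc n) (hmemI (mm n)) (hbd (mm n))⟩)
  exact le_of_tendsto_of_tendsto' (hl1.sub hl2') (hl3.const_mul c) hstep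

theorem integral_map_add_prod {E : Type*} [NormedAddCommGroup E]
    [MeasurableSpace E] [BorelSpace E] [SecondCountableTopology E]
    (μ₁ μ₂ : Measure E) [IsProbabilityMeasure μ₁] [IsProbabilityMeasure μ₂] {f : E → ℝ}
    (hf : Continuous f) {C : ℝ} (hC : ∀ x, ‖f x‖ ≤ C) :
    ∫ x, f x ∂((μ₁.prod μ₂).map fun p => p.1 + p.2) = ∫ y, (∫ x, f (x + y) ∂μ₁) ∂μ₂ := by
  rw [integral_map (by fun_prop) hf.aestronglyMeasurable, integral_prod_symm]
  exact integrable_of_continuous_of_bounded (by fun_prop) (fun x => hC _)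

theorem PhiSobolev.convolution {E : Type*} [NormedAddCommGroup E] [InnerProductSpace ℝ E]
    [FiniteDimensional ℝ E] [MeasurableSpace E] [BorelSpace E]
    {I : Set ℝ} (hI : Convex ℝ I) (hIc : IsClosed I) {Φ g : ℝ → ℝ} (hΦ : ContinuousOn Φ I)
    (hg : ContinuousOn g I) (hg0 : ∀ u ∈ I, 0 ≤ g u)
    (hconv : ConvexOn ℝ (I ×ˢ (Set.univ : Set ℝ)) (fun p : ℝ × ℝ => g p.1 * p.2 ^ 2))
    {μ₁ μ₂ : Measure E} [IsProbabilityMeasure μ₁] [IsProbabilityMeasure μ₂] {c₁ c₂ : ℝ}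
    (hc₂ : 0 ≤ c₂) (hμ₁ : PhiSobolev I Φ g μ₁ c₁) (hμ₂ : PhiSobolev I Φ g μ₂ c₂) :
    PhiSobolev I Φ g ((μ₁.prod μ₂).map fun p => p.1 + p.2) (c₁ + c₂) := by
  rintro f hf hfI ⟨C, hC⟩ ⟨C', hC'⟩
  have hf1 : ContDiff ℝ 1 f := hf.of_le (by exact_mod_cast le_top)
  have hcf : Continuous f := hf.continuous
  have hcd : Continuous (fderiv ℝ f) := hf1.continuous_fderiv one_ne_zero
  obtain ⟨hgf, hgb⟩ := hg.comp_bounded hIc hcf hfI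
  obtain ⟨N, hN⟩ := hgb C
  obtain ⟨hΦf, hΦb⟩ := hΦ.comp_bounded hIc hcf hfI
  obtain ⟨B, hB⟩ := hΦb C
  have hΦB : ∀ x, ‖Φ (f x)‖ ≤ B := fun x => hB _ (hfI x) (hC x)
  have hGc : Continuous fun x => g (f x) * ‖fderiv ℝ f x‖ ^ 2 :=
    hgf.mul (hcd.norm.pow 2)
  have hM : ∀ x, ‖g (f x) * ‖fderiv ℝ f x‖ ^ 2‖ ≤ N * C' ^ 2 := fun x => by
    rw [norm_mul, norm_pow, norm_norm]
    have hN' := hN _ (hfI x) (hC x)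
    exact mul_le_mul hN' (pow_le_pow_left₀ (norm_nonneg _) (hC' _) 2) (by positivity)
      ((abs_nonneg _).trans hN')
  have hHc : Continuous fun y => ∫ w, f (w + y) ∂μ₁ := continuous_integral_translate μ₁ hcf hC
  have hmemI : ∀ y, ∫ w, f (w + y) ∂μ₁ ∈ I := fun y =>
    hI.integral_mem hIc (Eventually.of_forall fun _ => hfI _)
      (integrable_of_continuous_of_bounded (by fun_prop) (fun x => hC _))
  have hpt : ∀ y, ∫ x, Φ (f (x + y)) ∂μ₁ ≤ Φ (∫ x, f (x + y) ∂μ₁)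
      + c₁ * ∫ x, g (f (x + y)) * ‖fderiv ℝ f (x + y)‖ ^ 2 ∂μ₁ := fun y => by
    have h := hμ₁ (fun x => f (x + y)) (hf.comp (contDiff_id.add contDiff_const))
      (fun x => hfI _) ⟨C, fun x => hC _⟩
      ⟨C', fun x => by rw [fderiv_comp_add_right]; exact hC' _⟩
    simp only [fderiv_comp_add_right] at h
    linarith
  have hΦi : Integrable (fun y => Φ (∫ x, f (x + y) ∂μ₁)) μ₂ :=
    integrable_of_continuous_of_bounded (hΦ.comp_continuous hHc hmemI) fun y =>
      hB _ (hmemI y)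
        (norm_integral_le_of_forall_norm_le (f := fun w => f (w + y)) μ₁ fun w => hC (w + y))
  have hKi : Integrable
      (fun y => c₁ * ∫ x, g (f (x + y)) * ‖fderiv ℝ f (x + y)‖ ^ 2 ∂μ₁) μ₂ :=
    (integrable_of_continuous_of_bounded (continuous_integral_translate μ₁ hGc hM) fun y =>
      norm_integral_le_of_forall_norm_le μ₁ fun w => hM (w + y)).const_mul c₁
  have hLi : Integrable (fun y => ∫ x, Φ (f (x + y)) ∂μ₁) μ₂ :=
    integrable_of_continuous_of_bounded (continuous_integral_translate μ₁ hΦf hΦB) fun y =>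
      norm_integral_le_of_forall_norm_le μ₁ fun w => hΦB (w + y)
  have h1 := integral_mono hLi (hΦi.add hKi) hpt
  simp only [Pi.add_apply] at h1
  rw [integral_add hΦi hKi, integral_const_mul] at h1
  have h2 := hμ₂.integral_translate hI hIc hΦ hg hg0 hconv hc₂ μ₁ hf1 hfI hC hC' hGc hM
  rw [integral_map_add_prod μ₁ μ₂ hΦf hΦB, integral_map_add_prod μ₁ μ₂ hcf hC,
    integral_map_add_prod μ₁ μ₂ hGc hM]
  linarith

/-- **Stability of Φ-Sobolev inequalities by convolution.** Under `(H1)`, if the probability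
measures `μ₁, μ₂` on `ℝ^d` satisfy Φ-Sobolev inequalities with constants `c₁, c₂` (for smooth
bounded functions with bounded gradient, with energy `Φ''(f)‖∇f‖²`), then the convolution
`μ₁ * μ₂` (pushforward of `μ₁ ⊗ μ₂` under addition) satisfies a Φ-Sobolev inequality with
constant `c₁ + c₂`. -/
theorem phiSobolev_convolution
    {d : ℕ}
    (I : Set ℝ) (hI : Convex ℝ I) (hIc : IsClosed I)
    (Φ : ℝ → ℝ) (hΦ : ContDiffOn ℝ 2 Φ I) (hΦconv : ConvexOn ℝ I Φ)
    (hH1nonneg : ∀ u ∈ I, ∀ v : ℝ, 0 ≤ deriv (deriv Φ) u * v ^ 2)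
    (hH1conv : ConvexOn ℝ (I ×ˢ (Set.univ : Set ℝ))
      (fun p : ℝ × ℝ => deriv (deriv Φ) p.1 * p.2 ^ 2))
    (μ₁ μ₂ : Measure (EuclideanSpace ℝ (Fin d)))
    [IsProbabilityMeasure μ₁] [IsProbabilityMeasure μ₂]
    (c₁ c₂ : ℝ) (hc₁ : 0 < c₁) (hc₂ : 0 < c₂)
    (hμ₁ : ∀ f : EuclideanSpace ℝ (Fin d) → ℝ, ContDiff ℝ (⊤ : ℕ∞) f → (∀ x, f x ∈ I) →
      (∃ C : ℝ, ∀ x, |f x| ≤ C) → (∃ C : ℝ, ∀ x, ‖gradient f x‖ ≤ C) →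
      (∫ x, Φ (f x) ∂μ₁) - Φ (∫ x, f x ∂μ₁)
        ≤ c₁ * ∫ x, deriv (deriv Φ) (f x) * ‖gradient f x‖ ^ 2 ∂μ₁)
    (hμ₂ : ∀ f : EuclideanSpace ℝ (Fin d) → ℝ, ContDiff ℝ (⊤ : ℕ∞) f → (∀ x, f x ∈ I) →
      (∃ C : ℝ, ∀ x, |f x| ≤ C) → (∃ C : ℝ, ∀ x, ‖gradient f x‖ ≤ C) →
      (∫ x, Φ (f x) ∂μ₂) - Φ (∫ x, f x ∂μ₂)
        ≤ c₂ * ∫ x, deriv (deriv Φ) (f x) * ‖gradient f x‖ ^ 2 ∂μ₂)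
    (ν : Measure (EuclideanSpace ℝ (Fin d)))
    (hν : ν = (μ₁.prod μ₂).map (fun p => p.1 + p.2)) :
    ∀ f : EuclideanSpace ℝ (Fin d) → ℝ, ContDiff ℝ (⊤ : ℕ∞) f → (∀ x, f x ∈ I) →
      (∃ C : ℝ, ∀ x, |f x| ≤ C) → (∃ C : ℝ, ∀ x, ‖gradient f x‖ ≤ C) →
      (∫ x, Φ (f x) ∂ν) - Φ (∫ x, f x ∂ν)
        ≤ (c₁ + c₂) * ∫ x, deriv (deriv Φ) (f x) * ‖gradient f x‖ ^ 2 ∂ν := by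
  rcases (interior I).eq_empty_or_nonempty with hemp | hne
  · rintro f - hfI - -
    have hsub : I.Subsingleton := by
      intro a ha b hb
      by_contra hab
      rcases lt_or_gt_of_ne hab with h | h
      · have := interior_mono (hI.ordConnected.out ha hb)
        rw [interior_Icc, hemp] at this
        exact (Set.nonempty_Ioo.2 h).not_subset_empty this
      · have := interior_mono (hI.ordConnected.out hb ha)
        rw [interior_Icc, hemp] at this
        exact (Set.nonempty_Ioo.2 h).not_subset_empty this
    have : IsProbabilityMeasure ν := hν ▸ Measure.isProbabilityMeasure_map (by fun_prop)
    have hconst : ∀ x, f x = f 0 := fun x => hsub (hfI x) (hfI 0)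
    have h0 : 0 ≤ ∫ x, deriv (deriv Φ) (f x) * ‖gradient f x‖ ^ 2 ∂ν :=
      integral_nonneg fun x => hH1nonneg _ (hfI x) _
    have hL : (∫ x, Φ (f x) ∂ν) - Φ (∫ x, f x ∂ν) = 0 := by simp [hconst]
    rw [hL]
    positivity
  · obtain ⟨g, hg, hgeq⟩ := hΦ.exists_continuousOn_eq_deriv_deriv hI hne
    have hcl : closure (interior I) = I := by
      rw [hI.closure_interior_eq_closure_of_nonempty_interior hne, hIc.closure_eq]
    have hg0 : ∀ u ∈ I, 0 ≤ g u := by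
      have hm : Set.MapsTo g (interior I) (Set.Ici 0) := fun u hu => by
        simpa [hgeq u hu] using hH1nonneg u (interior_subset hu) 1
      have hm' := hm.closure_of_continuousOn (by rwa [hcl])
      rw [hcl, closure_Ici] at hm'
      exact hm'
    have hint : interior (I ×ˢ (Set.univ : Set ℝ)) = interior I ×ˢ Set.univ := by
      rw [interior_prod_eq, interior_univ]
    have hconv : ConvexOn ℝ (I ×ˢ (Set.univ : Set ℝ)) (fun p : ℝ × ℝ => g p.1 * p.2 ^ 2) := by
      refine ConvexOn.of_interior_of_continuousOn (hI.prod convex_univ)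
        (hint ▸ hne.prod Set.univ_nonempty)
        ((hg.comp continuousOn_fst fun p hp => hp.1).mul (continuousOn_snd.pow 2)) ?_
      refine (hH1conv.subset interior_subset (hI.prod convex_univ).interior).congr
        fun p hp => ?_
      rw [hint] at hp
      simp only [hgeq p.1 hp.1]
    have henergy : ∀ f : EuclideanSpace ℝ (Fin d) → ℝ, (∀ x, f x ∈ I) → ∀ x,
        deriv (deriv Φ) (f x) * ‖gradient f x‖ ^ 2 = g (f x) * ‖fderiv ℝ f x‖ ^ 2 := by
      intro f hfI x
      rw [norm_gradient_eq_norm_fderiv]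
      by_cases hx : f x ∈ interior I
      · rw [hgeq _ hx]
      · simp [fderiv_eq_zero_of_notMem_interior hI hfI hx]
    have hS₁ : PhiSobolev I Φ g μ₁ c₁ := fun f hf hfI hb hb' => by
      simpa only [henergy f hfI] using
        hμ₁ f hf hfI hb (by simpa only [norm_gradient_eq_norm_fderiv] using hb')
    have hS₂ : PhiSobolev I Φ g μ₂ c₂ := fun f hf hfI hb hb' => by
      simpa only [henergy f hfI] using
        hμ₂ f hf hfI hb (by simpa only [norm_gradient_eq_norm_fderiv] using hb')
    intro f hf hfI hb hb'
    subst hν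
    simp only [henergy f hfI]
    exact hS₁.convolution hI hIc hΦ.continuousOn hg hg0 hconv hc₂.le hS₂ f hf hfI hb
      (by simpa only [norm_gradient_eq_norm_fderiv] using hb')
end

section
/- Let I ⊆ ℝ be a closed interval with nonempty interior and Φ : I → ℝ a smooth convex function, and suppose there exists a point a in the interior of I with Φ''(a) > 0. Let μ be a probability measure on ℝ^d and c > 0 be such that for every smooth bounded function f : ℝ^d → I with bounded gradient, Ent_μ^Φ(f) ≤ c · ∫ Φ''(f) · ‖∇f‖² dμ. Then μ satisfies the Poincaré inequality: for every smooth bounded function g : ℝ^d → ℝ with bounded gradient, Var_μ(g) ≤ 2c · ∫ ‖∇g‖² dμ, where Var_μ(g) := ∫ g² dμ − (∫ g dμ)². -/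
open MeasureTheory

theorem integrable_comp_of_continuousOn_isCompact {X : Type*} [TopologicalSpace X]
    [MeasurableSpace X] [BorelSpace X] {μ : Measure X} [IsFiniteMeasure μ] {K : Set ℝ}
    (hK : IsCompact K) {h : ℝ → ℝ} (hh : ContinuousOn h K) {f : X → ℝ} (hf : Continuous f)
    (hfK : ∀ x, f x ∈ K) : Integrable (fun x => h (f x)) μ := by
  obtain ⟨C, hC⟩ := hK.exists_bound_of_continuousOn hh
  exact .of_bound (hh.comp_continuous hf hfK).aestronglyMeasurable C
    (.of_forall fun x => hC _ (hfK x))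

/-- If `Φ'' ≥ k` on `[l, u]`, then the `Φ`-entropy dominates `k / 2` times the variance. -/
theorem half_mul_variance_le_entropy {X : Type*} [TopologicalSpace X]
    [MeasurableSpace X] [BorelSpace X] {μ : Measure X} [IsProbabilityMeasure μ] {l u k : ℝ}
    {Φ Φ' Φ'' : ℝ → ℝ} (hΦ : ∀ x ∈ Set.Icc l u, HasDerivAt Φ (Φ' x) x)
    (hΦ' : ∀ x ∈ Set.Icc l u, HasDerivAt Φ' (Φ'' x) x) (hk : ∀ x ∈ Set.Icc l u, k ≤ Φ'' x)
    {f : X → ℝ} (hf : Continuous f) (hfK : ∀ x, f x ∈ Set.Icc l u) :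
    k / 2 * ((∫ x, f x ^ 2 ∂μ) - (∫ x, f x ∂μ) ^ 2)
      ≤ (∫ x, Φ (f x) ∂μ) - Φ (∫ x, f x ∂μ) := by
  have hΦc : ContinuousOn Φ (Set.Icc l u) := fun x hx =>
    (hΦ x hx).continuousAt.continuousWithinAt
  have hc : ContinuousOn (fun y => Φ y - k / 2 * y ^ 2) (Set.Icc l u) := by fun_prop
  have hconv : ConvexOn ℝ (Set.Icc l u) (fun y => Φ y - k / 2 * y ^ 2) := by
    refine convexOn_of_hasDerivWithinAt2_nonneg (f' := fun y => Φ' y - k * y)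
      (f'' := fun y => Φ'' y - k) (convex_Icc l u) hc (fun x hx => ?_) (fun x hx => ?_)
      fun x hx => sub_nonneg.2 (hk x (interior_subset hx))
    · exact (((hΦ x (interior_subset hx)).fun_sub
        ((hasDerivAt_pow 2 x).const_mul (k / 2))).congr_deriv (by simp; ring)).hasDerivWithinAt
    · exact (((hΦ' x (interior_subset hx)).fun_sub
        ((hasDerivAt_id' x).const_mul k)).congr_deriv (by simp)).hasDerivWithinAt
  have hi := integrable_comp_of_continuousOn_isCompact (μ := μ) isCompact_Icc hΦc hf hfK
  have hi2 := integrable_comp_of_continuousOn_isCompact (μ := μ) isCompact_Icc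
    (h := fun y => y ^ 2) (by fun_prop) hf hfK
  have hJ := hconv.map_integral_le (μ := μ) (f := f) hc isClosed_Icc (.of_forall hfK)
    (integrable_comp_of_continuousOn_isCompact isCompact_Icc continuousOn_id hf hfK)
    (integrable_comp_of_continuousOn_isCompact isCompact_Icc hc hf hfK)
  rw [integral_sub hi (hi2.const_mul _), integral_const_mul] at hJ
  linarith

theorem gradient_const_add_const_mul {E : Type*} [NormedAddCommGroup E] [InnerProductSpace ℝ E]
    [CompleteSpace E] (a t : ℝ) {g : E → ℝ} {x : E} (hg : DifferentiableAt ℝ g x) :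
    gradient (fun y => a + t * g y) x = t • gradient g x := by
  simp only [gradient]
  rw [fderiv_const_add, fderiv_const_mul hg, map_smul]

theorem integral_sq_sub_sq_integral_const_add_const_mul {X : Type*} [MeasurableSpace X]
    {μ : Measure X} [IsProbabilityMeasure μ] (a t : ℝ) {g : X → ℝ} (hg : Integrable g μ)
    (hg2 : Integrable (fun x => g x ^ 2) μ) :
    (∫ x, (a + t * g x) ^ 2 ∂μ) - (∫ x, a + t * g x ∂μ) ^ 2
      = t ^ 2 * ((∫ x, g x ^ 2 ∂μ) - (∫ x, g x ∂μ) ^ 2) := by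
  have h : ∀ x, (a + t * g x) ^ 2 = a ^ 2 + (2 * a * t * g x + t ^ 2 * g x ^ 2) :=
    fun x => by ring
  have hsum : Integrable (fun x => 2 * a * t * g x + t ^ 2 * g x ^ 2) μ :=
    (hg.const_mul _).add (hg2.const_mul _)
  simp_rw [h]
  rw [integral_add (integrable_const _) hsum,
    integral_add (hg.const_mul _) (hg2.const_mul _),
    integral_add (integrable_const _) (hg.const_mul _)]
  simp only [integral_const_mul, integral_const, probReal_univ, one_smul]
  ring

/-- **Φ-Sobolev implies Poincaré.** If `Φ` is smooth convex on a closed interval `I` with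
`Φ''(a) > 0` at some interior point `a`, and `μ` satisfies a Φ-Sobolev inequality with
constant `c` for smooth bounded functions with bounded gradient, then `μ` satisfies the
Poincaré inequality `Var_μ(g) ≤ 2c ∫ ‖∇g‖² dμ`. -/
theorem phiSobolev_implies_poincare
    {d : ℕ}
    (I : Set ℝ) (hI : Convex ℝ I) (hIc : IsClosed I)
    (Φ : ℝ → ℝ) (hΦ : ContDiffOn ℝ (⊤ : ℕ∞) Φ I) (hΦconv : ConvexOn ℝ I Φ)
    (a : ℝ) (ha : a ∈ interior I) (ha' : 0 < deriv (deriv Φ) a)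
    (μ : Measure (EuclideanSpace ℝ (Fin d))) [IsProbabilityMeasure μ]
    (c : ℝ) (hc : 0 < c)
    (hμ : ∀ f : EuclideanSpace ℝ (Fin d) → ℝ, ContDiff ℝ (⊤ : ℕ∞) f → (∀ x, f x ∈ I) →
      (∃ C : ℝ, ∀ x, |f x| ≤ C) → (∃ C : ℝ, ∀ x, ‖gradient f x‖ ≤ C) →
      (∫ x, Φ (f x) ∂μ) - Φ (∫ x, f x ∂μ)
        ≤ c * ∫ x, deriv (deriv Φ) (f x) * ‖gradient f x‖ ^ 2 ∂μ) :
    ∀ g : EuclideanSpace ℝ (Fin d) → ℝ, ContDiff ℝ (⊤ : ℕ∞) g →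
      (∃ C : ℝ, ∀ x, |g x| ≤ C) → (∃ C : ℝ, ∀ x, ‖gradient g x‖ ≤ C) →
      (∫ x, g x ^ 2 ∂μ) - (∫ x, g x ∂μ) ^ 2 ≤ 2 * c * ∫ x, ‖gradient g x‖ ^ 2 ∂μ := by
  intro g hg ⟨B, hB⟩ ⟨G, hG⟩
  set V := (∫ x, g x ^ 2 ∂μ) - (∫ x, g x ∂μ) ^ 2
  set D := ∫ x, ‖gradient g x‖ ^ 2 ∂μ
  set k := deriv (deriv Φ) a
  have hΦ0 : ContDiffOn ℝ (⊤ : ℕ∞) Φ (interior I) := hΦ.mono interior_subset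
  have hΦ1 : ContDiffOn ℝ (⊤ : ℕ∞) (deriv Φ) (interior I) :=
    hΦ0.deriv_of_isOpen isOpen_interior (by simp)
  have hΦ2 : ContinuousOn (deriv (deriv Φ)) (interior I) :=
    hΦ1.continuousOn_deriv_of_isOpen isOpen_interior (by simp)
  have hgi : Integrable g μ :=
    .of_bound hg.continuous.aestronglyMeasurable B (.of_forall hB)
  have hgi2 : Integrable (fun x => g x ^ 2) μ :=
    .of_bound (hg.continuous.pow 2).aestronglyMeasurable (B ^ 2) (.of_forall fun x => by
      rw [Real.norm_eq_abs, abs_pow]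
      exact pow_le_pow_left₀ (abs_nonneg _) (hB x) 2)
  have hgradc : Continuous (gradient g) :=
    (InnerProductSpace.toDual ℝ _).symm.continuous.comp (hg.continuous_fderiv (by simp))
  have hGi : Integrable (fun x => ‖gradient g x‖ ^ 2) μ :=
    .of_bound (hgradc.norm.pow 2).aestronglyMeasurable (G ^ 2) (.of_forall fun x => by
      rw [Real.norm_eq_abs, abs_pow, abs_norm]
      exact pow_le_pow_left₀ (norm_nonneg _) (hG x) 2)
  have key : ∀ δ > 0, (k - δ) / 2 * V ≤ c * ((k + δ) * D) := by
    intro δ hδ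
    have hnhds : ∀ᶠ y in nhds a, y ∈ interior I ∧ |deriv (deriv Φ) y - k| < δ :=
      (isOpen_interior.eventually_mem ha).and
        ((hΦ2.continuousAt (isOpen_interior.mem_nhds ha)).eventually
          (Metric.ball_mem_nhds _ hδ))
    obtain ⟨r, hr, hball⟩ := Metric.nhds_basis_closedBall.eventually_iff.1 hnhds
    rw [Real.closedBall_eq_Icc] at hball
    obtain ⟨t, ht, htB⟩ : ∃ t > 0, t * |B| ≤ r :=
      ⟨r / (|B| + 1), by positivity, by
        rw [div_mul_eq_mul_div, div_le_iff₀ (by positivity)]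
        nlinarith [abs_nonneg B]⟩
    set f : EuclideanSpace ℝ (Fin d) → ℝ := fun x => a + t * g x with hfdef
    have hf : ContDiff ℝ (⊤ : ℕ∞) f := contDiff_const.add (contDiff_const.mul hg)
    have hfK : ∀ x, f x ∈ Set.Icc (a - r) (a + r) := fun x => by
      have h : |t * g x| ≤ r := by
        rw [abs_mul, abs_of_pos ht]
        exact (mul_le_mul_of_nonneg_left ((hB x).trans (le_abs_self B)) ht.le).trans htB
      have := abs_le.1 h
      constructor <;> simp only [hfdef] <;> linarith
    have hgrad : ∀ x, gradient f x = t • gradient g x := fun x =>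
      gradient_const_add_const_mul a t (hg.differentiable (by simp) x)
    have hfbound : ∀ x, |f x| ≤ max |a - r| |a + r| := fun x =>
      abs_le_max_abs_abs (hfK x).1 (hfK x).2
    have hsob := hμ f hf (fun x => interior_subset (hball (hfK x)).1) ⟨_, hfbound⟩
      ⟨t * G, fun x => by
        rw [hgrad, norm_smul, Real.norm_eq_abs, abs_of_pos ht]
        exact mul_le_mul_of_nonneg_left (hG x) ht.le⟩
    have hlow := half_mul_variance_le_entropy (μ := μ) (Φ := Φ) (k := k - δ)
      (fun x hx => ((hΦ0.differentiableOn (by simp)).differentiableAt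
        (isOpen_interior.mem_nhds (hball hx).1)).hasDerivAt)
      (fun x hx => ((hΦ1.differentiableOn (by simp)).differentiableAt
        (isOpen_interior.mem_nhds (hball hx).1)).hasDerivAt)
      (fun x hx => by linarith [(abs_lt.1 (hball hx).2).1]) hf.continuous hfK
    rw [integral_sq_sub_sq_integral_const_add_const_mul a t hgi hgi2] at hlow
    have hup : ∫ x, deriv (deriv Φ) (f x) * ‖gradient f x‖ ^ 2 ∂μ ≤ t ^ 2 * ((k + δ) * D) := by
      rw [← integral_const_mul, ← integral_const_mul]
      have hcomp : Continuous fun x => deriv (deriv Φ) (f x) :=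
        hΦ2.comp_continuous hf.continuous fun x => (hball (hfK x)).1
      refine integral_mono ?_ ((hGi.const_mul _).const_mul _) fun x => ?_
      · simp only [hgrad, norm_smul, mul_pow]
        refine (hGi.const_mul _).bdd_mul (c := |k| + δ) hcomp.aestronglyMeasurable
          (.of_forall fun x => ?_)
        have := abs_sub_abs_le_abs_sub (deriv (deriv Φ) (f x)) k
        rw [Real.norm_eq_abs]
        linarith [(hball (hfK x)).2]
      · have h : deriv (deriv Φ) (f x) ≤ k + δ := by
          linarith [(abs_lt.1 (hball (hfK x)).2).2]
        calc deriv (deriv Φ) (f x) * ‖gradient f x‖ ^ 2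
            ≤ (k + δ) * ‖gradient f x‖ ^ 2 := by gcongr
          _ = t ^ 2 * ((k + δ) * ‖gradient g x‖ ^ 2) := by
            rw [hgrad, norm_smul, mul_pow, Real.norm_eq_abs, sq_abs]
            ring
    have h := (hlow.trans hsob).trans (mul_le_mul_of_nonneg_left hup hc.le)
    refine le_of_mul_le_mul_left ?_ (pow_pos ht 2)
    linarith
  have hlim : k / 2 * V ≤ c * (k * D) := by
    have hL : Filter.Tendsto (fun δ : ℝ => (k - δ) / 2 * V) (nhdsWithin 0 (Set.Ioi 0))
        (nhds ((k - 0) / 2 * V)) :=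
      (Continuous.tendsto (by fun_prop) 0).mono_left nhdsWithin_le_nhds
    have hR : Filter.Tendsto (fun δ : ℝ => c * ((k + δ) * D)) (nhdsWithin 0 (Set.Ioi 0))
        (nhds (c * ((k + 0) * D))) :=
      (Continuous.tendsto (by fun_prop) 0).mono_left nhdsWithin_le_nhds
    simpa using le_of_tendsto_of_tendsto hL hR (eventually_mem_nhdsWithin.mono key)
  refine le_of_mul_le_mul_left ?_ ha'
  linarith
end

section
/- Let μ be a probability measure on a measurable space Ω and let f : Ω → (0,∞) be a bounded measurable function with inf f > 0. Then lim_{p → 1⁺} (∫ f^p dμ − (∫ f dμ)^p)/(p − 1) = ∫ f·log f dμ − (∫ f dμ)·log(∫ f dμ); in other words, the classical entropy Ent_μ(f) is the right derivative at p = 1 of the map p ↦ ∫ f^p dμ − (∫ f dμ)^p. -/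
open MeasureTheory Filter

/-- **Entropy as a derivative of `p`-moments at `p = 1`.** For a bounded measurable `f > 0`
bounded away from `0` on a probability space, the quantity `(∫ f^p dμ − (∫ f dμ)^p)/(p−1)`
converges, as `p → 1⁺`, to the classical entropy
`Ent_μ(f) = ∫ f log f dμ − (∫ f dμ) log (∫ f dμ)`. -/
theorem tendsto_pMoment_div_sub_one_entropy
    {Ω : Type*} [MeasurableSpace Ω] (μ : Measure Ω) [IsProbabilityMeasure μ]
    (f : Ω → ℝ) (hfm : Measurable f)
    (hfpos : ∃ ε : ℝ, 0 < ε ∧ ∀ ω, ε ≤ f ω) (hfbdd : ∃ C : ℝ, ∀ ω, f ω ≤ C) :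
    Tendsto
      (fun p : ℝ => ((∫ ω, f ω ^ p ∂μ) - (∫ ω, f ω ∂μ) ^ p) / (p - 1))
      (nhdsWithin 1 (Set.Ioi 1))
      (nhds ((∫ ω, f ω * Real.log (f ω) ∂μ)
        - (∫ ω, f ω ∂μ) * Real.log (∫ ω, f ω ∂μ))) := by
  obtain ⟨ε, hε, hfε⟩ := hfpos
  obtain ⟨C, hfC⟩ := hfbdd
  have hpos : ∀ ω, 0 < f ω := fun ω => hε.trans_le (hfε ω)
  have hfint : Integrable f μ :=
    Integrable.of_bound hfm.aestronglyMeasurable C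
      (ae_of_all _ fun ω => by rw [Real.norm_of_nonneg (hpos ω).le]; exact hfC ω)
  have hmean : 0 < ∫ ω, f ω ∂μ := by
    refine hε.trans_le ?_
    simpa using integral_mono (integrable_const ε) hfint hfε
  have hmoment : HasDerivAt (fun p : ℝ => ∫ ω, f ω ^ p ∂μ)
      (∫ ω, f ω ^ (1 : ℝ) * Real.log (f ω) ∂μ) 1 := by
    refine (hasDerivAt_integral_of_dominated_loc_of_deriv_le
      (F := fun (p : ℝ) ω => f ω ^ p) (F' := fun p ω => f ω ^ p * Real.log (f ω))
      (s := Set.Ioo 0 2) (bound := fun _ => max C 1 ^ (2 : ℝ) * (|Real.log ε| + |Real.log C|))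
      (Ioo_mem_nhds one_pos one_lt_two) ?_ ?_ ?_ ?_ (integrable_const _) ?_).2
    · exact Eventually.of_forall fun p => (hfm.pow_const p).aestronglyMeasurable
    · simpa using hfint
    · exact ((hfm.pow_const _).mul hfm.log).aestronglyMeasurable
    · refine ae_of_all _ fun ω p hp => ?_
      rw [norm_mul, Real.norm_of_nonneg (Real.rpow_nonneg (hpos ω).le p), Real.norm_eq_abs]
      refine mul_le_mul ?_ ?_ (abs_nonneg _) (by positivity)
      · calc f ω ^ p ≤ max C 1 ^ p :=
              Real.rpow_le_rpow (hpos ω).le ((hfC ω).trans (le_max_left _ _)) hp.1.le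
          _ ≤ max C 1 ^ (2 : ℝ) := Real.rpow_le_rpow_of_exponent_le (le_max_right _ _) hp.2.le
      · have hlow := Real.log_le_log hε (hfε ω)
        have hup := Real.log_le_log (hpos ω) (hfC ω)
        rw [abs_le]
        constructor
        · linarith [neg_abs_le (Real.log ε), abs_nonneg (Real.log C)]
        · linarith [le_abs_self (Real.log C), abs_nonneg (Real.log ε)]
    · exact ae_of_all _ fun ω p _ => (Real.hasStrictDerivAt_const_rpow (hpos ω) p).hasDerivAt
  have hderiv := hmoment.sub (Real.hasStrictDerivAt_const_rpow hmean 1).hasDerivAt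
  have hslope := (hasDerivAt_iff_tendsto_slope.mp hderiv).mono_left
    (nhdsWithin_mono (s := Set.Ioi 1) 1 fun p hp => ne_of_gt hp)
  simpa [slope_fun_def_field] using hslope
end
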